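/- In coordinate form, the commutativity of the complex Dunkl operators reads: let R ⊂ ℝ^N ⊂ ℂ^N be a root system with positive subsystem R_+, G the complex Coxeter group generated by {σ_v : v ∈ R}, and κ a G-invariant multiplicity function; then for all 1 ≤ i, j ≤ N and all polynomials p ∈ ℂ[z_1,…,z_N], 𝒟_i 𝒟_j p = 𝒟_j 𝒟_i p, where 𝒟_j p(z) = ∂p(z)/∂z_j + Σ_{v ∈ R_+} κ_v ((p(z) − p(zσ_v))/⟨z, v⟩) v_j. -/

import Mathlib

open MvPolynomial

noncomputable section

/-- The bilinear extension `(z, w) = Σ_j z_j w_j` of the Euclidean inner product to `ℂ^N`;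
for `v ∈ ℝ^N` this is `⟨z, v⟩ = Σ_j z_j v_j`. -/
def bilinC {N : ℕ} (z w : Fin N → ℂ) : ℂ := ∑ j, z j * w j

/-- The Euclidean inner product on `ℝ^N`. -/
def bilinR {N : ℕ} (x y : Fin N → ℝ) : ℝ := ∑ j, x j * y j

/-- The standard embedding `ℝ^N ↪ ℂ^N`. -/
def cplx {N : ℕ} (v : Fin N → ℝ) : Fin N → ℂ := fun j => (v j : ℂ)

/-- The real reflection `σ_u(x) = x − 2(⟨x,u⟩/‖u‖²) u`. -/
def reflR {N : ℕ} (u x : Fin N → ℝ) : Fin N → ℝ :=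
  x - (2 * bilinR x u / bilinR u u) • u

/-- The linear polynomial `z ↦ ⟨z, v⟩`. -/
def linPoly {N : ℕ} (v : Fin N → ℝ) : MvPolynomial (Fin N) ℂ :=
  ∑ i, C ((v i : ℂ)) * X i

/-- The polynomial `z ↦ p(zσ_v)`. -/
def reflPoly {N : ℕ} (v : Fin N → ℝ) (p : MvPolynomial (Fin N) ℂ) : MvPolynomial (Fin N) ℂ :=
  aeval (fun j => X j - C (((2 * v j / bilinR v v : ℝ) : ℂ)) * linPoly v) p

/-- The difference-quotient operator `ρ_v p = (p − p∘σ_v)/⟨ · , v⟩` on polynomials: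
the (unique, as the quotient by a nonzero linear polynomial) polynomial `q` with
`p − p∘σ_v = ⟨·,v⟩ · q`. -/
def rhoPoly {N : ℕ} (v : Fin N → ℝ) (p : MvPolynomial (Fin N) ℂ) : MvPolynomial (Fin N) ℂ :=
  letI := Classical.dec (linPoly v ∣ (p - reflPoly v p))
  if h : linPoly v ∣ (p - reflPoly v p) then h.choose else 0

/-- The `j`-th complex Dunkl operator on polynomials:
`𝒟_j p(z) = ∂p(z)/∂z_j + Σ_{v ∈ R₊} κ_v ((p(z) − p(zσ_v))/⟨z,v⟩) v_j`. -/
def dunklD {N : ℕ} (Rp : Finset (Fin N → ℝ)) (κ : (Fin N → ℝ) → ℂ) (j : Fin N)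
    (p : MvPolynomial (Fin N) ℂ) : MvPolynomial (Fin N) ℂ :=
  pderiv j p + ∑ v ∈ Rp, C (κ v * (v j : ℂ)) * rhoPoly v p

section helpers
variable {N : ℕ}

lemma bilinR_self_ne {v : Fin N → ℝ} (hv : v ≠ 0) : bilinR v v ≠ 0 := by
  intro h
  apply hv
  unfold bilinR at h
  rw [Finset.sum_eq_zero_iff_of_nonneg (fun i _ => mul_self_nonneg _)] at h
  ext i
  exact mul_self_eq_zero.1 (h i (Finset.mem_univ _))

lemma bilinR_comm' (u v : Fin N → ℝ) : bilinR u v = bilinR v u := by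
  unfold bilinR
  exact Finset.sum_congr rfl fun i _ => mul_comm _ _

lemma bilinR_sub_smul (u v w : Fin N → ℝ) (c : ℝ) :
    bilinR (u - c • v) w = bilinR u w - c * bilinR v w := by
  simp only [bilinR, Pi.sub_apply, Pi.smul_apply, smul_eq_mul, Finset.mul_sum,
    ← Finset.sum_sub_distrib]
  exact Finset.sum_congr rfl fun i _ => by ring

lemma reflR_bilin_left {u : Fin N → ℝ} (hu : u ≠ 0) (v : Fin N → ℝ) :
    bilinR (reflR u v) u = - bilinR v u := by
  have := bilinR_self_ne hu
  unfold reflR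
  rw [bilinR_sub_smul]
  field_simp
  ring

lemma reflR_bilin_self {u : Fin N → ℝ} (hu : u ≠ 0) (v : Fin N → ℝ) :
    bilinR (reflR u v) (reflR u v) = bilinR v v := by
  have h := bilinR_self_ne hu
  have h1 := reflR_bilin_left hu v
  have h2 : bilinR (reflR u v) (reflR u v) = bilinR v (reflR u v) -
      (2 * bilinR v u / bilinR u u) * bilinR u (reflR u v) := bilinR_sub_smul _ _ _ _
  have h3 : bilinR (reflR u v) v = bilinR v v -
      (2 * bilinR v u / bilinR u u) * bilinR u v := bilinR_sub_smul _ _ _ _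
  rw [h2, bilinR_comm' u (reflR u v), h1, bilinR_comm' v (reflR u v), h3, bilinR_comm' u v]
  ring

lemma reflR_invol {u : Fin N → ℝ} (hu : u ≠ 0) (v : Fin N → ℝ) :
    reflR u (reflR u v) = v := by
  have h1 := reflR_bilin_left hu v
  have h2 : reflR u (reflR u v) = reflR u v - (2 * bilinR (reflR u v) u / bilinR u u) • u := rfl
  rw [h2, h1]
  unfold reflR
  ext i
  simp
  ring

lemma reflR_self {u : Fin N → ℝ} (hu : u ≠ 0) : reflR u u = -u := by
  have h := bilinR_self_ne hu
  ext i
  simp [reflR]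
  field_simp
  ring

lemma pderiv_linPoly (v : Fin N → ℝ) (i : Fin N) :
    pderiv i (linPoly v) = C ((v i : ℂ)) := by
  simp [linPoly, pderiv_X, Pi.single_apply]

lemma linPoly_ne {v : Fin N → ℝ} (hv : v ≠ 0) : linPoly v ≠ 0 := by
  intro h
  apply hv
  ext i
  have := pderiv_linPoly v i
  rw [h, map_zero] at this
  have h2 := (C_eq_zero (σ := Fin N)).1 this.symm
  simpa using h2

lemma linPoly_sub_smul (u v : Fin N → ℝ) (c : ℝ) :
    linPoly (u - c • v) = linPoly u - C (c : ℂ) * linPoly v := by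
  simp only [linPoly, Pi.sub_apply, Pi.smul_apply, smul_eq_mul, Finset.mul_sum,
    ← Finset.sum_sub_distrib]
  exact Finset.sum_congr rfl fun i _ => by push_cast; simp only [map_sub, map_mul]; ring

lemma linPoly_neg (v : Fin N → ℝ) : linPoly (-v) = - linPoly v := by
  simp [linPoly]

lemma reflPoly_neg (v : Fin N → ℝ) (p : MvPolynomial (Fin N) ℂ) :
    reflPoly (-v) p = reflPoly v p := by
  have : bilinR (-v) (-v) = bilinR v v := by simp [bilinR]
  unfold reflPoly
  rw [this, linPoly_neg]
  congr 2
  ext1 j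
  congr 1
  rw [Pi.neg_apply, mul_neg (2 : ℝ), neg_div, Complex.ofReal_neg, map_neg, neg_mul_neg]

lemma reflPoly_add (v : Fin N → ℝ) (p q : MvPolynomial (Fin N) ℂ) :
    reflPoly v (p + q) = reflPoly v p + reflPoly v q := map_add _ _ _

lemma reflPoly_sub (v : Fin N → ℝ) (p q : MvPolynomial (Fin N) ℂ) :
    reflPoly v (p - q) = reflPoly v p - reflPoly v q := map_sub _ _ _

lemma reflPoly_mul (v : Fin N → ℝ) (p q : MvPolynomial (Fin N) ℂ) :
    reflPoly v (p * q) = reflPoly v p * reflPoly v q := map_mul _ _ _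

lemma reflPoly_C (v : Fin N → ℝ) (c : ℂ) :
    reflPoly v (C c) = C c := by simp [reflPoly, MvPolynomial.algebraMap_eq]

lemma reflPoly_X (v : Fin N → ℝ) (j : Fin N) :
    reflPoly v (X j) = X j - C (((2 * v j / bilinR v v : ℝ) : ℂ)) * linPoly v := by
  simp [reflPoly]

lemma reflPoly_linPoly (u v : Fin N → ℝ) :
    reflPoly u (linPoly v) = linPoly (reflR u v) := by
  unfold reflR
  rw [linPoly_sub_smul]
  have : reflPoly u (linPoly v) = ∑ j, reflPoly u (C ((v j : ℂ)) * X j) := by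
    unfold reflPoly linPoly
    rw [map_sum]
  rw [this]
  simp only [reflPoly_mul, reflPoly_C, reflPoly_X, mul_sub, Finset.sum_sub_distrib]
  congr 1
  rw [show bilinR v u = ∑ j, v j * u j from rfl, Finset.mul_sum, Finset.sum_div, Complex.ofReal_sum, map_sum, Finset.sum_mul]
  refine Finset.sum_congr rfl fun i _ => ?_
  rw [← mul_assoc, ← C_mul]
  congr 2
  push_cast
  ring

lemma reflPoly_conj {u v : Fin N → ℝ} (hu : u ≠ 0) (hv : v ≠ 0)
    (p : MvPolynomial (Fin N) ℂ) :
    reflPoly u (reflPoly v p) = reflPoly (reflR u v) (reflPoly u p) := by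
  induction p using MvPolynomial.induction_on with
  | C a => simp only [reflPoly_C]
  | add p q hp hq => simp only [reflPoly_add, hp, hq]
  | mul_X p j hp =>
    simp only [reflPoly_mul, hp]
    refine congrArg₂ (· * ·) rfl ?_
    have h1 := bilinR_self_ne hu
    have h2 := bilinR_self_ne hv
    simp only [reflPoly_X, reflPoly_sub, reflPoly_mul, reflPoly_C, reflPoly_linPoly,
      reflR_bilin_self hu]
    have e : reflR (reflR u v) u = u - (-(2 * bilinR v u / bilinR v v)) • reflR u v := by
      have := reflR_bilin_self hu v
      have h3 := reflR_bilin_left hu v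
      rw [show reflR (reflR u v) u = u - (2 * bilinR u (reflR u v) /
        bilinR (reflR u v) (reflR u v)) • reflR u v from rfl, this, bilinR_comm' u, h3]
      congr 2
      ring
    rw [e, linPoly_sub_smul]
    have e2 : C ((2 * v j / bilinR v v : ℝ) : ℂ) =
      (C ((2 * (reflR u v) j / bilinR v v : ℝ) : ℂ) + C ((2 * u j / bilinR u u : ℝ) : ℂ) *
        C ((2 * bilinR v u / bilinR v v : ℝ) : ℂ) : MvPolynomial (Fin N) ℂ) := by
      rw [← C_mul, ← C_add, ← Complex.ofReal_mul, ← Complex.ofReal_add]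
      congr 2
      simp only [reflR, Pi.sub_apply, Pi.smul_apply, smul_eq_mul]
      field_simp
      ring
    rw [e2, Complex.ofReal_neg, map_neg]
    ring

lemma lin_dvd (v : Fin N → ℝ) (p : MvPolynomial (Fin N) ℂ) :
    linPoly v ∣ p - reflPoly v p := by
  induction p using MvPolynomial.induction_on with
  | C a => simp [reflPoly_C]
  | add p q hp hq =>
    rw [reflPoly_add, add_sub_add_comm]
    exact dvd_add hp hq
  | mul_X p j hp =>
    obtain ⟨q, hq⟩ := hp
    rw [reflPoly_mul, reflPoly_X]
    refine ⟨q * X j + reflPoly v p * C (((2 * v j / bilinR v v : ℝ) : ℂ)), ?_⟩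
    linear_combination X j * hq

lemma lin_mul_rho (v : Fin N → ℝ) (p : MvPolynomial (Fin N) ℂ) :
    linPoly v * rhoPoly v p = p - reflPoly v p := by
  unfold rhoPoly
  rw [dif_pos (lin_dvd v p)]
  exact (lin_dvd v p).choose_spec.symm

lemma rho_add {v : Fin N → ℝ} (hv : v ≠ 0) (p q : MvPolynomial (Fin N) ℂ) :
    rhoPoly v (p + q) = rhoPoly v p + rhoPoly v q := by
  apply mul_left_cancel₀ (linPoly_ne hv)
  rw [mul_add]
  simp only [lin_mul_rho, reflPoly_add]
  ring

lemma rho_C_mul {v : Fin N → ℝ} (hv : v ≠ 0) (c : ℂ) (q : MvPolynomial (Fin N) ℂ) :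
    rhoPoly v (C c * q) = C c * rhoPoly v q := by
  apply mul_left_cancel₀ (linPoly_ne hv)
  rw [mul_left_comm]
  simp only [lin_mul_rho, reflPoly_mul, reflPoly_C]
  ring

lemma rho_sum {v : Fin N → ℝ} (hv : v ≠ 0) {ι : Type*} (s : Finset ι)
    (f : ι → MvPolynomial (Fin N) ℂ) :
    rhoPoly v (∑ k ∈ s, f k) = ∑ k ∈ s, rhoPoly v (f k) :=
  map_sum (AddMonoidHom.mk' (rhoPoly v) (rho_add hv)) f s

lemma rho_neg {v : Fin N → ℝ} (hv : v ≠ 0) (p : MvPolynomial (Fin N) ℂ) :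
    rhoPoly (-v) p = - rhoPoly v p := by
  apply mul_left_cancel₀ (linPoly_ne hv)
  have := lin_mul_rho (-v) p
  rw [linPoly_neg, reflPoly_neg, ← lin_mul_rho] at this
  linear_combination -this

lemma pderiv_refl (v : Fin N → ℝ) (i : Fin N) (p : MvPolynomial (Fin N) ℂ) :
    pderiv i (reflPoly v p) = reflPoly v (pderiv i p) -
      C ((v i : ℂ)) * ∑ k, C (((2 * v k / bilinR v v : ℝ) : ℂ)) * reflPoly v (pderiv k p) := by
  induction p using MvPolynomial.induction_on with
  | C a =>
    have : reflPoly v 0 = 0 := map_zero _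
    simp [reflPoly_C, this]
  | add p q hp hq =>
    simp only [reflPoly_add, map_add, hp, hq, mul_add, Finset.sum_add_distrib]
    ring
  | mul_X p j hp =>
    have e : ∀ k, reflPoly v (pderiv k (p * X j)) =
        reflPoly v (pderiv k p) * reflPoly v (X j) + reflPoly v p * (if k = j then 1 else 0) := by
      intro k
      rw [pderiv_mul, reflPoly_add, reflPoly_mul, reflPoly_mul, pderiv_X, Pi.single_apply]
      congr 2
      have h1 : reflPoly v 1 = 1 := map_one _
      have h0 : reflPoly v 0 = 0 := map_zero _
      by_cases h : k = j
      · simp [h, h1]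
      · simp [h, Ne.symm h, h0]
    have e2 : pderiv i (reflPoly v (X j)) = (if i = j then 1 else 0) -
        C (((2 * v j / bilinR v v : ℝ) : ℂ)) * C ((v i : ℂ)) := by
      rw [reflPoly_X, map_sub, pderiv_C_mul, pderiv_linPoly, pderiv_X, Pi.single_apply]
      by_cases h : i = j
      · simp [h]
      · simp [h, Ne.symm h]
    rw [reflPoly_mul, pderiv_mul, hp, e2]
    simp only [e, mul_add, Finset.sum_add_distrib]
    have e3 : ∑ k, C (((2 * v k / bilinR v v : ℝ) : ℂ)) *
        (reflPoly v p * (if k = j then 1 else 0)) =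
        C (((2 * v j / bilinR v v : ℝ) : ℂ)) * reflPoly v p := by
      simp
    have e4 : ∑ k, C (((2 * v k / bilinR v v : ℝ) : ℂ)) *
        (reflPoly v (pderiv k p) * reflPoly v (X j)) =
        (∑ k, C (((2 * v k / bilinR v v : ℝ) : ℂ)) * reflPoly v (pderiv k p)) *
          reflPoly v (X j) := by
      rw [Finset.sum_mul]
      exact Finset.sum_congr rfl fun k _ => by ring
    rw [e3, e4]
    ring

lemma cross {v : Fin N → ℝ} (hv : v ≠ 0) (i j : Fin N) (p : MvPolynomial (Fin N) ℂ) :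
    C ((v j : ℂ)) * (pderiv i (rhoPoly v p) - rhoPoly v (pderiv i p)) =
    C ((v i : ℂ)) * (pderiv j (rhoPoly v p) - rhoPoly v (pderiv j p)) := by
  apply mul_left_cancel₀ (linPoly_ne hv)
  have key : ∀ i, linPoly v * (pderiv i (rhoPoly v p) - rhoPoly v (pderiv i p)) =
      C ((v i : ℂ)) * (∑ k, C (((2 * v k / bilinR v v : ℝ) : ℂ)) * reflPoly v (pderiv k p)
        - rhoPoly v p) := by
    intro i
    have h := congrArg (pderiv i) (lin_mul_rho v p)
    rw [pderiv_mul, pderiv_linPoly, map_sub, pderiv_refl] at h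
    have h2 := lin_mul_rho v (pderiv i p)
    linear_combination h - h2
  linear_combination C ((v j : ℂ)) * key i - C ((v i : ℂ)) * key j

/-- antisymmetric form -/
def asym (i j : Fin N) (u v : Fin N → ℝ) : ℂ := (u i : ℂ) * v j - u j * v i

lemma asym_swap (i j : Fin N) (u v : Fin N → ℝ) : asym i j v u = - asym i j u v := by
  unfold asym; ring

lemma asym_refl (i j : Fin N) (u v : Fin N → ℝ) :
    asym i j u (reflR u v) = asym i j u v := by
  simp only [asym, reflR, Pi.sub_apply, Pi.smul_apply, smul_eq_mul]
  push_cast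
  ring

lemma span_tau (u v : Fin N → ℝ) :
    Submodule.span ℝ {v, reflR v u} = Submodule.span ℝ {u, v} := by
  apply le_antisymm
  · rw [Submodule.span_le]
    rintro x (rfl | rfl)
    · exact Submodule.subset_span (by simp)
    · exact Submodule.sub_mem _ (Submodule.subset_span (by simp))
        (Submodule.smul_mem _ _ (Submodule.subset_span (by simp)))
  · rw [Submodule.span_le]
    rintro x (rfl | rfl)
    · have h : x = reflR v x + (2 * bilinR x v / bilinR v v) • v := by simp [reflR]
      rw [h]
      refine Submodule.add_mem _ (Submodule.subset_span ?_)
        (Submodule.smul_mem _ _ (Submodule.subset_span (by simp)))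
      rw [← h]; simp
    · exact Submodule.subset_span (by simp)

lemma plucker (i j : Fin N) {u v e : Fin N → ℝ} (he : e ∈ Submodule.span ℝ {u, v}) :
    C (asym i j u v) * linPoly e = C (asym i j e v) * linPoly u - C (asym i j e u) * linPoly v := by
  obtain ⟨a, b, rfl⟩ := Submodule.mem_span_pair.1 he
  have h1 : linPoly (a • u + b • v) = C (a : ℂ) * linPoly u + C (b : ℂ) * linPoly v := by
    have := linPoly_sub_smul (a • u) v (-b)
    have h2 := linPoly_sub_smul 0 u (-a)
    have h3 : linPoly (0 : Fin N → ℝ) = 0 := by simp [linPoly]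
    simp only [neg_smul, sub_neg_eq_add, zero_add, Complex.ofReal_neg, map_neg, neg_mul, h3] at this h2
    rw [this, h2]
  have h2 : asym i j (a • u + b • v) v = a * asym i j u v := by
    simp [asym]; ring
  have h3 : asym i j (a • u + b • v) u = - (b * asym i j u v) := by
    simp [asym]; ring
  rw [h1, h2, h3]
  simp only [map_neg, map_mul]
  ring

/-- The telescoping argument. -/
lemma telescope {K : Type*} [Field K] (A : MvPolynomial (Fin N) ℂ →+* K)
    (hinj : Function.Injective A) {R : Finset (Fin N → ℝ)} (hR0 : (0 : Fin N → ℝ) ∉ R)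
    (hRrefl : ∀ u ∈ R, ∀ x ∈ R, reflR u x ∈ R) (i j : Fin N)
    (F : (Fin N → ℝ) → (Fin N → ℝ) → K)
    (hF : ∀ u ∈ R, ∀ v ∈ R, F v (reflR v u) = F u v) :
    ∑ x ∈ R ×ˢ R, A (C (asym i j x.1 x.2)) * F x.1 x.2 /
      (A (linPoly x.1) * A (linPoly x.2)) = 0 := by
  classical
  have hne : ∀ u ∈ R, u ≠ 0 := fun u hu h => hR0 (h ▸ hu)
  have hL : ∀ u ∈ R, A (linPoly u) ≠ 0 := fun u hu h =>
    linPoly_ne (hne u hu) (hinj (by rw [map_zero]; exact h))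
  set key : (Fin N → ℝ) × (Fin N → ℝ) → Submodule ℝ (Fin N → ℝ) :=
    fun x => Submodule.span ℝ {x.1, x.2} with hkey
  rw [← Finset.sum_fiberwise_of_maps_to (t := (R ×ˢ R).image key) (g := key)
    (fun x hx => Finset.mem_image_of_mem _ hx)]
  refine Finset.sum_eq_zero fun P hP => ?_
  obtain ⟨⟨e, e'⟩, he, rfl⟩ := Finset.mem_image.1 hP
  have heR : e ∈ R := (Finset.mem_product.1 he).1
  set S := (R ×ˢ R).filter (fun x => key x = key (e, e')) with hS
  let t : (Fin N → ℝ) → K := fun u => A (C (asym i j e u)) / (A (linPoly e) * A (linPoly u))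
  have h1 : ∀ x ∈ S, A (C (asym i j x.1 x.2)) * F x.1 x.2 /
      (A (linPoly x.1) * A (linPoly x.2)) = t x.2 * F x.1 x.2 - t x.1 * F x.1 x.2 := by
    rintro ⟨u, v⟩ hx
    obtain ⟨hx1, hx2⟩ := Finset.mem_filter.1 hx
    obtain ⟨hu, hv⟩ := Finset.mem_product.1 hx1
    have hm : e ∈ Submodule.span ℝ {u, v} := by
      have : e ∈ key (e, e') := Submodule.subset_span (by simp)
      rw [← hx2] at this
      exact this
    have hp := congrArg A (plucker i j hm)
    simp only [map_mul, map_sub] at hp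
    have := hL u hu
    have := hL v hv
    have := hL e heR
    simp only [t]
    dsimp only at *
    field_simp
    linear_combination F u v * hp
  rw [Finset.sum_congr rfl h1, Finset.sum_sub_distrib, sub_eq_zero]
  symm
  have h2 : ∀ u ∈ R, ∀ v ∈ R, key (v, reflR v u) = key (u, v) := fun u _ v _ => span_tau u v
  symm
  refine Finset.sum_bij' (fun x _ => (x.2, reflR x.2 x.1)) (fun x _ => (reflR x.1 x.2, x.1))
    ?_ ?_ ?_ ?_ ?_
  · rintro ⟨u, v⟩ hx
    obtain ⟨hx1, hx2⟩ := Finset.mem_filter.1 hx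
    obtain ⟨hu, hv⟩ := Finset.mem_product.1 hx1
    exact Finset.mem_filter.2 ⟨Finset.mem_product.2 ⟨hv, hRrefl v hv u hu⟩,
      (h2 u hu v hv).trans hx2⟩
  · rintro ⟨u, v⟩ hx
    obtain ⟨hx1, hx2⟩ := Finset.mem_filter.1 hx
    obtain ⟨hu, hv⟩ := Finset.mem_product.1 hx1
    refine Finset.mem_filter.2 ⟨Finset.mem_product.2 ⟨hRrefl u hu v hv, hu⟩, ?_⟩
    have := h2 (reflR u v) (hRrefl u hu v hv) u hu
    rw [reflR_invol (hne u hu)] at this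
    exact this.symm.trans hx2
  · rintro ⟨u, v⟩ hx
    obtain ⟨hx1, hx2⟩ := Finset.mem_filter.1 hx
    obtain ⟨hu, hv⟩ := Finset.mem_product.1 hx1
    simp [reflR_invol (hne v hv)]
  · rintro ⟨u, v⟩ hx
    obtain ⟨hx1, hx2⟩ := Finset.mem_filter.1 hx
    obtain ⟨hu, hv⟩ := Finset.mem_product.1 hx1
    simp [reflR_invol (hne u hu)]
  · rintro ⟨u, v⟩ hx
    obtain ⟨hx1, hx2⟩ := Finset.mem_filter.1 hx
    obtain ⟨hu, hv⟩ := Finset.mem_product.1 hx1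
    simp only [hF u hu v hv]

lemma sum_refl_right {M : Type*} [AddCommMonoid M] {R : Finset (Fin N → ℝ)}
    (hR0 : (0 : Fin N → ℝ) ∉ R)
    (hRrefl : ∀ u ∈ R, ∀ x ∈ R, reflR u x ∈ R) (f : (Fin N → ℝ) → (Fin N → ℝ) → M) :
    ∑ x ∈ R ×ˢ R, f x.1 (reflR x.1 x.2) = ∑ x ∈ R ×ˢ R, f x.1 x.2 := by
  have hne : ∀ u ∈ R, u ≠ 0 := fun u hu h => hR0 (h ▸ hu)
  rw [Finset.sum_product, Finset.sum_product]
  refine Finset.sum_congr rfl fun u hu => ?_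
  exact Finset.sum_bij' (fun v _ => reflR u v) (fun v _ => reflR u v)
    (fun v hv => hRrefl u hu v hv) (fun v hv => hRrefl u hu v hv)
    (fun v _ => reflR_invol (hne u hu) v) (fun v _ => reflR_invol (hne u hu) v)
    (fun v _ => rfl)

lemma sum_swap {M : Type*} [AddCommMonoid M] (R : Finset (Fin N → ℝ))
    (f : (Fin N → ℝ) → (Fin N → ℝ) → M) :
    ∑ x ∈ R ×ˢ R, f x.2 x.1 = ∑ x ∈ R ×ˢ R, f x.1 x.2 := by
  rw [Finset.sum_product, Finset.sum_product]
  exact Finset.sum_comm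

lemma double_R_aux {K : Type*} [Field K] [CharZero K] (A : MvPolynomial (Fin N) ℂ →+* K)
    (hinj : Function.Injective A) {R : Finset (Fin N → ℝ)} (κ : (Fin N → ℝ) → ℂ)
    (hR0 : (0 : Fin N → ℝ) ∉ R)
    (hRrefl : ∀ u ∈ R, ∀ x ∈ R, reflR u x ∈ R)
    (hκ : ∀ u ∈ R, ∀ w ∈ R, κ (reflR w u) = κ u)
    (i j : Fin N) (p : MvPolynomial (Fin N) ℂ) :
    ∑ x ∈ R ×ˢ R, C (κ x.1 * κ x.2 * asym i j x.1 x.2) * rhoPoly x.1 (rhoPoly x.2 p) = 0 := by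
  have hne : ∀ u ∈ R, u ≠ 0 := fun u hu h => hR0 (h ▸ hu)
  have hL : ∀ u ∈ R, A (linPoly u) ≠ 0 := fun u hu h =>
    linPoly_ne (hne u hu) (hinj (by rw [map_zero]; exact h))
  apply hinj
  rw [map_zero, map_sum]
  let w : (Fin N → ℝ) → (Fin N → ℝ) → K := fun u v => A (C (κ u * κ v * asym i j u v))
  have hw1 : ∀ u v, w v u = - w u v := by
    intro u v
    simp only [w]
    rw [asym_swap i j u v, ← map_neg, ← C_neg]
    congr 2; ring
  have hw2 : ∀ u ∈ R, ∀ v ∈ R, w u (reflR u v) = w u v := by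
    intro u hu v hv
    simp only [w]
    rw [asym_refl, hκ v hv u hu]
  let l : (Fin N → ℝ) → K := fun u => A (linPoly u)
  let s : (Fin N → ℝ) → K := fun u => A (reflPoly u p)
  let d : (Fin N → ℝ) → (Fin N → ℝ) → K := fun u v => A (reflPoly u (reflPoly v p))
  have hd : ∀ u ∈ R, ∀ v ∈ R, d u (reflR u v) = d v u := by
    intro u hu v hv
    simp only [d]
    rw [reflPoly_conj (hne u hu) (hne _ (hRrefl u hu v hv)), reflR_invol (hne u hu)]
  let a1 : (Fin N → ℝ) → (Fin N → ℝ) → K := fun u v => w u v * A p / (l u * l v)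
  let a2 : (Fin N → ℝ) → (Fin N → ℝ) → K := fun u v => w u v * s v / (l u * l v)
  let a4 : (Fin N → ℝ) → (Fin N → ℝ) → K := fun u v => w u v * d u v / (l u * l v)
  have hterm : ∀ x ∈ R ×ˢ R, A (C (κ x.1 * κ x.2 * asym i j x.1 x.2) *
      rhoPoly x.1 (rhoPoly x.2 p)) = a1 x.1 x.2 - a2 x.1 x.2 + a2 (reflR x.1 x.2) x.1
        - a4 (reflR x.1 x.2) x.1 := by
    rintro ⟨u, v⟩ hx
    obtain ⟨hu, hv⟩ := Finset.mem_product.1 hx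
    have e1 := congrArg A (lin_mul_rho u (rhoPoly v p))
    have e2 := congrArg A (lin_mul_rho v p)
    have e3 := congrArg A (congrArg (reflPoly u) (lin_mul_rho v p))
    rw [reflPoly_mul, reflPoly_sub, reflPoly_linPoly] at e3
    simp only [map_mul, map_sub] at e1 e2 e3
    have l1 := hL u hu
    have l2 := hL v hv
    have l3 := hL _ (hRrefl u hu v hv)
    have hd' : d (reflR u v) u = d u v := by
      rw [← hd u hu _ (hRrefl u hu v hv), reflR_invol (hne u hu)]
    have hw' : w (reflR u v) u = - w u v := by
      rw [hw1, hw2 u hu v hv]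
    simp only [a1, a2, a4, hd', hw', map_mul A]
    rw [show A (C (κ u * κ v * asym i j u v)) = w u v from rfl]
    have f2 : A (rhoPoly v p) = (A p - s v) / l v := by
      rw [eq_div_iff l2, mul_comm]; exact e2
    have f3 : A (reflPoly u (rhoPoly v p)) = (s u - d u v) / l (reflR u v) := by
      rw [eq_div_iff l3, mul_comm]; exact e3
    have f1 : A (rhoPoly u (rhoPoly v p)) =
        ((A p - s v) / l v - (s u - d u v) / l (reflR u v)) / l u := by
      rw [eq_div_iff l1, mul_comm, ← f2, ← f3]; exact e1
    rw [f1]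
    change l u ≠ 0 at l1
    change l v ≠ 0 at l2
    change l (reflR u v) ≠ 0 at l3
    field_simp
    ring
  rw [Finset.sum_congr rfl hterm]
  simp only [Finset.sum_sub_distrib, Finset.sum_add_distrib]
  rw [sum_refl_right hR0 hRrefl (fun u v => a2 v u), sum_refl_right hR0 hRrefl (fun u v => a4 v u),
    sum_swap R a2, sum_swap R a4]
  have t1 : ∑ x ∈ R ×ˢ R, a1 x.1 x.2 = 0 := by
    have h := sum_swap R a1
    have h2 : ∑ x ∈ R ×ˢ R, a1 x.2 x.1 = - ∑ x ∈ R ×ˢ R, a1 x.1 x.2 := by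
      rw [← Finset.sum_neg_distrib]
      refine Finset.sum_congr rfl fun x _ => ?_
      simp only [a1]
      rw [hw1 x.1 x.2, mul_comm (l x.2)]
      ring
    rw [h2] at h
    exact self_eq_neg.1 h.symm
  have t4 : ∑ x ∈ R ×ˢ R, a4 x.1 x.2 = 0 := by
    have := telescope A hinj hR0 hRrefl i j (fun u v => A (C (κ u * κ v)) * d u v) (by
      intro u hu v hv
      rw [hd v hv u hu, hκ u hu v hv, mul_comm (κ v)])
    rw [← this]
    refine Finset.sum_congr rfl fun x _ => ?_
    simp only [a4, w, l]
    rw [C_mul, map_mul A]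
    ring
  rw [t1, t4]
  ring

lemma double_R {R : Finset (Fin N → ℝ)} (κ : (Fin N → ℝ) → ℂ)
    (hR0 : (0 : Fin N → ℝ) ∉ R)
    (hRrefl : ∀ u ∈ R, ∀ x ∈ R, reflR u x ∈ R)
    (hκ : ∀ u ∈ R, ∀ w ∈ R, κ (reflR w u) = κ u)
    (i j : Fin N) (p : MvPolynomial (Fin N) ℂ) :
    ∑ x ∈ R ×ˢ R, C (κ x.1 * κ x.2 * asym i j x.1 x.2) * rhoPoly x.1 (rhoPoly x.2 p) = 0 := by
  have hinj := IsFractionRing.injective (MvPolynomial (Fin N) ℂ)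
    (FractionRing (MvPolynomial (Fin N) ℂ))
  have : CharZero (FractionRing (MvPolynomial (Fin N) ℂ)) :=
    charZero_of_injective_algebraMap hinj
  exact double_R_aux (algebraMap _ _) hinj κ hR0 hRrefl hκ i j p

lemma sum_even {M : Type*} [AddCommMonoid M] {R Rp : Finset (Fin N → ℝ)}
    (hRpos : ∀ u : Fin N → ℝ, u ∈ R ↔ u ∈ Rp ∨ -u ∈ Rp)
    (hRpdisj : ∀ u ∈ Rp, -u ∉ Rp) (f : (Fin N → ℝ) → M)
    (hf : ∀ u ∈ Rp, f (-u) = f u) :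
    ∑ u ∈ R, f u = 2 • ∑ u ∈ Rp, f u := by
  classical
  have h : R = Rp ∪ Rp.image (fun u => -u) := by
    ext u
    rw [hRpos, Finset.mem_union, Finset.mem_image]
    constructor
    · rintro (h | h)
      · exact Or.inl h
      · exact Or.inr ⟨_, h, neg_neg u⟩
    · rintro (h | ⟨a, h, rfl⟩)
      · exact Or.inl h
      · exact Or.inr (by simpa using h)
  rw [h, Finset.sum_union, Finset.sum_image, two_smul, Finset.sum_congr rfl hf]
  · intro a _ b _ hab
    exact neg_injective hab
  · rw [Finset.disjoint_left]
    intro a ha hb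
    obtain ⟨b, hb', rfl⟩ := Finset.mem_image.1 hb
    exact hRpdisj b hb' ha

lemma double_Rp {R Rp : Finset (Fin N → ℝ)} (κ : (Fin N → ℝ) → ℂ)
    (hR0 : (0 : Fin N → ℝ) ∉ R)
    (hRrefl : ∀ u ∈ R, ∀ x ∈ R, reflR u x ∈ R)
    (hRpos : ∀ u : Fin N → ℝ, u ∈ R ↔ u ∈ Rp ∨ -u ∈ Rp)
    (hRpdisj : ∀ u ∈ Rp, -u ∉ Rp)
    (hκ : ∀ u ∈ R, ∀ w ∈ R, κ (reflR w u) = κ u)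
    (i j : Fin N) (p : MvPolynomial (Fin N) ℂ) :
    ∑ u ∈ Rp, ∑ v ∈ Rp, C (κ u * κ v * asym i j u v) * rhoPoly u (rhoPoly v p) = 0 := by
  have hne : ∀ u ∈ R, u ≠ 0 := fun u hu h => hR0 (h ▸ hu)
  have hsub : ∀ u ∈ Rp, u ∈ R := fun u hu => (hRpos u).2 (Or.inl hu)
  have hκn : ∀ u ∈ R, κ (-u) = κ u := fun u hu => by
    rw [← reflR_self (hne u hu), hκ u hu u hu]
  have h := double_R κ hR0 hRrefl hκ i j p
  rw [Finset.sum_product] at h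
  have a1 : ∀ u v, asym i j (-u) v = - asym i j u v := by intro u v; simp [asym]; ring
  have a2 : ∀ u v, asym i j u (-v) = - asym i j u v := by intro u v; simp [asym]; ring
  have hr : ∀ u ∈ R, ∀ q, rhoPoly u (-q) = - rhoPoly u q := by
    intro u hu q
    have := rho_C_mul (hne u hu) (-1) q
    simpa using this
  rw [sum_even hRpos hRpdisj] at h
  · have h2 : ∀ u ∈ Rp, ∑ v ∈ R, C (κ u * κ v * asym i j u v) * rhoPoly u (rhoPoly v p) =
        2 • ∑ v ∈ Rp, C (κ u * κ v * asym i j u v) * rhoPoly u (rhoPoly v p) := by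
      intro u hu
      refine sum_even hRpos hRpdisj _ fun v hv => ?_
      rw [hκn v (hsub v hv), a2, rho_neg (hne v (hsub v hv)), hr u (hsub u hu)]
      simp
    rw [Finset.sum_congr rfl h2, ← Finset.smul_sum] at h
    simpa using h
  · intro u hu
    refine Finset.sum_congr rfl fun v _ => ?_
    rw [hκn u (hsub u hu), a1, rho_neg (hne u (hsub u hu))]
    simp

lemma dunkl_expand {Rp : Finset (Fin N → ℝ)} (κ : (Fin N → ℝ) → ℂ)
    (hne : ∀ u ∈ Rp, u ≠ 0) (i j : Fin N) (p : MvPolynomial (Fin N) ℂ) :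
    dunklD Rp κ i (dunklD Rp κ j p) = pderiv i (pderiv j p) +
      ∑ v ∈ Rp, (C (κ v * (v j : ℂ)) * pderiv i (rhoPoly v p) +
        C (κ v * (v i : ℂ)) * rhoPoly v (pderiv j p)) +
      ∑ u ∈ Rp, ∑ v ∈ Rp, C (κ u * κ v * ((u i : ℂ) * v j)) * rhoPoly u (rhoPoly v p) := by
  have h1 : ∀ u ∈ Rp, C (κ u * (u i : ℂ)) * rhoPoly u (dunklD Rp κ j p) =
      C (κ u * (u i : ℂ)) * rhoPoly u (pderiv j p) +
      ∑ v ∈ Rp, C (κ u * κ v * ((u i : ℂ) * v j)) * rhoPoly u (rhoPoly v p) := by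
    intro u hu
    unfold dunklD
    rw [rho_add (hne u hu), rho_sum (hne u hu), mul_add, Finset.mul_sum]
    refine congrArg₂ (· + ·) rfl ?_
    refine Finset.sum_congr rfl fun v _ => ?_
    rw [rho_C_mul (hne u hu), ← mul_assoc, ← C_mul]
    refine congrArg (fun c => C c * _) ?_
    ring
  conv_lhs => unfold dunklD
  rw [show (pderiv j p + ∑ v ∈ Rp, C (κ v * (v j : ℂ)) * rhoPoly v p) = dunklD Rp κ j p from rfl,
    Finset.sum_congr rfl h1, Finset.sum_add_distrib, Finset.sum_add_distrib]
  have h2 : pderiv i (dunklD Rp κ j p) = pderiv i (pderiv j p) +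
      ∑ v ∈ Rp, C (κ v * (v j : ℂ)) * pderiv i (rhoPoly v p) := by
    unfold dunklD
    rw [map_add, map_sum]
    simp only [pderiv_C_mul]
  rw [h2]
  ring

lemma pderiv_comm' (i j : Fin N) (p : MvPolynomial (Fin N) ℂ) :
    pderiv i (pderiv j p) = pderiv j (pderiv i p) := by
  have h : ⁅(pderiv i : Derivation ℂ (MvPolynomial (Fin N) ℂ) (MvPolynomial (Fin N) ℂ)),
      (pderiv j : Derivation ℂ (MvPolynomial (Fin N) ℂ) (MvPolynomial (Fin N) ℂ))⁆ = 0 := by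
    apply MvPolynomial.derivation_ext
    intro k
    simp [Derivation.commutator_apply, pderiv_X, Pi.single_apply, apply_ite]
  have h2 := congrArg (fun D : Derivation ℂ (MvPolynomial (Fin N) ℂ) _ => D p) h
  simp only [Derivation.commutator_apply] at h2
  exact sub_eq_zero.1 h2

end helpers

/-- commutativity of complex Dunkl operators, coordinate form: for a root
system `R ⊂ ℝ^N ⊂ ℂ^N` with positive subsystem `R₊` and a multiplicity function `κ`
invariant under the complex Coxeter group (equivalently, under its generating
reflections), `𝒟_i 𝒟_j p = 𝒟_j 𝒟_i p` for all `1 ≤ i, j ≤ N` and all polynomials `p`. -/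
theorem stmt10 {N : ℕ} (R Rp : Finset (Fin N → ℝ)) (κ : (Fin N → ℝ) → ℂ)
    (hR0 : (0 : Fin N → ℝ) ∉ R)
    (hRrefl : ∀ u ∈ R, ∀ x ∈ R, reflR u x ∈ R)
    (hRline : ∀ u ∈ R, ∀ x ∈ R, (∃ c : ℝ, x = c • u) → x = u ∨ x = -u)
    (hRneg : ∀ u ∈ R, -u ∈ R)
    (hRpos : ∀ u : Fin N → ℝ, u ∈ R ↔ u ∈ Rp ∨ -u ∈ Rp)
    (hRpdisj : ∀ u ∈ Rp, -u ∉ Rp)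
    (hκ : ∀ u ∈ R, ∀ w ∈ R, κ (reflR w u) = κ u)
    (i j : Fin N) (p : MvPolynomial (Fin N) ℂ) :
    dunklD Rp κ i (dunklD Rp κ j p) = dunklD Rp κ j (dunklD Rp κ i p) := by
  have hsub : ∀ u ∈ Rp, u ∈ R := fun u hu => (hRpos u).2 (Or.inl hu)
  have hne : ∀ u ∈ Rp, u ≠ 0 := fun u hu h => hR0 (h ▸ hsub u hu)
  rw [dunkl_expand κ hne, dunkl_expand κ hne, pderiv_comm' i j]
  have hd := double_Rp κ hR0 hRrefl hRpos hRpdisj hκ i j p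
  have e : ∑ u ∈ Rp, ∑ v ∈ Rp, C (κ u * κ v * ((u i : ℂ) * v j)) * rhoPoly u (rhoPoly v p) =
      ∑ u ∈ Rp, ∑ v ∈ Rp, C (κ u * κ v * ((u j : ℂ) * v i)) * rhoPoly u (rhoPoly v p) := by
    rw [← sub_eq_zero, ← hd, ← Finset.sum_sub_distrib]
    refine Finset.sum_congr rfl fun u _ => ?_
    rw [← Finset.sum_sub_distrib]
    refine Finset.sum_congr rfl fun v _ => ?_
    rw [← sub_mul, ← C_sub]
    refine congrArg (fun c => C c * _) ?_
    unfold asym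
    ring
  rw [e]
  refine congrArg₂ (· + ·) (congrArg₂ (· + ·) rfl ?_) rfl
  refine Finset.sum_congr rfl fun v hv => ?_
  have hc := cross (hne v hv) i j p
  simp only [C_mul]
  linear_combination C (κ v) * hc
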